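/- arXiv:1307.5016 — 6 statements merged into one kernel-verified Lean document; each statement's English description precedes it below -/
import Mathlib

section
/- Let C ⊆ ℝ^d be a proper open convex cone. For every x ∈ C, the function φ ↦ exp(−⟪φ, x⟫) is integrable on the dual cone C* with respect to Lebesgue measure, and the characteristic function satisfies 0 < f_C(x) < ∞. -/
open MeasureTheory Set
open scoped RealInnerProductSpace ENNReal

/-- A proper open convex cone in Euclidean space: a nonempty open convex set,
closed under positive scalar multiplication, whose closure contains no line. -/
structure IsProperOpenConvexCone {d : ℕ} (C : Set (EuclideanSpace ℝ (Fin d))) : Prop where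
  nonempty : C.Nonempty
  isOpen : IsOpen C
  convex : Convex ℝ C
  smul_mem : ∀ t : ℝ, 0 < t → ∀ x ∈ C, t • x ∈ C
  salient : closure C ∩ (-closure C) = {0}

/-- The dual cone of `C`: functionals (identified with vectors via the inner
product) that are nonnegative on the closure of `C`. -/
def dualConeSet {d : ℕ} (C : Set (EuclideanSpace ℝ (Fin d))) : Set (EuclideanSpace ℝ (Fin d)) :=
  {φ | ∀ x ∈ closure C, 0 ≤ ⟪φ, x⟫}

/-- The characteristic function of the cone `C`. -/
noncomputable def charFn {d : ℕ} (C : Set (EuclideanSpace ℝ (Fin d)))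
    (x : EuclideanSpace ℝ (Fin d)) : ℝ≥0∞ :=
  ∫⁻ φ in dualConeSet C, ENNReal.ofReal (Real.exp (-⟪φ, x⟫))

theorem mem_closure_of_dual {d : ℕ} (C : Set (EuclideanSpace ℝ (Fin d)))
    (hC : IsProperOpenConvexCone C) (y : EuclideanSpace ℝ (Fin d))
    (hy : ∀ φ ∈ dualConeSet C, 0 ≤ ⟪φ, y⟫) : y ∈ closure C := by
  by_contra hn
  obtain ⟨f, u, hfy, hfu⟩ := geometric_hahn_banach_point_closed hC.convex.closure isClosed_closure hn
  have h0 : (0 : EuclideanSpace ℝ (Fin d)) ∈ closure C := by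
    have : (0 : EuclideanSpace ℝ (Fin d)) ∈ closure C ∩ (-closure C) := by
      rw [hC.salient]; rfl
    exact this.1
  have hu : u < 0 := by simpa using hfu 0 h0
  have hpos : ∀ c ∈ C, 0 ≤ f c := by
    intro c hc
    by_contra hneg
    push Not at hneg
    have h1 : 0 < u / f c := div_pos_of_neg_of_neg hu hneg
    have h2 := hfu _ (subset_closure (hC.smul_mem _ h1 c hc))
    rw [map_smul, smul_eq_mul, div_mul_cancel₀ _ hneg.ne] at h2
    exact lt_irrefl _ h2
  have hpos' : ∀ c ∈ closure C, 0 ≤ f c := by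
    have hcl : IsClosed {c | 0 ≤ f c} := isClosed_le continuous_const f.continuous
    exact fun c hc => closure_minimal (fun c hc => hpos c hc) hcl hc
  have h := hy ((InnerProductSpace.toDual ℝ _).symm f) (by
    intro c hc
    rw [InnerProductSpace.toDual_symm_apply]
    exact hpos' c hc)
  rw [InnerProductSpace.toDual_symm_apply] at h
  linarith

theorem dual_interior {d : ℕ} (C : Set (EuclideanSpace ℝ (Fin d)))
    (hC : IsProperOpenConvexCone C) : (interior (dualConeSet C)).Nonempty := by
  have hconv : Convex ℝ (dualConeSet C) := by
    intro a ha b hb s t hs ht _ c hc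
    rw [inner_add_left, real_inner_smul_left, real_inner_smul_left]
    exact add_nonneg (mul_nonneg hs (ha c hc)) (mul_nonneg ht (hb c hc))
  have h0 : (0 : EuclideanSpace ℝ (Fin d)) ∈ dualConeSet C := by
    intro c _; simp
  rw [hconv.interior_nonempty_iff_affineSpan_eq_top,
    AffineSubspace.affineSpan_eq_top_iff_vectorSpan_eq_top_of_nonempty ℝ _ _ ⟨0, h0⟩,
    vectorSpan_eq_span_vsub_set_right ℝ h0]
  simp only [vsub_eq_sub, sub_zero, image_id']
  rw [← Submodule.orthogonal_eq_bot_iff, Submodule.eq_bot_iff]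
  intro y hy
  rw [Submodule.mem_orthogonal] at hy
  have hy' : ∀ φ ∈ dualConeSet C, ⟪φ, y⟫ = 0 := fun φ h => hy φ (Submodule.subset_span h)
  have h1 := mem_closure_of_dual C hC y (fun φ h => (hy' φ h).ge)
  have h2 := mem_closure_of_dual C hC (-y) (fun φ h => by rw [inner_neg_right, hy' φ h]; simp)
  have : y ∈ closure C ∩ (-closure C) := ⟨h1, h2⟩
  rw [hC.salient] at this
  exact this

theorem integrable_exp_neg_norm_aux {d : ℕ} (r : ℝ) (hr : 0 < r) :
    Integrable (fun φ : EuclideanSpace ℝ (Fin d) => Real.exp (-(r * ‖φ‖))) volume := by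
  have hb : ∃ K : ℝ, ∀ s : ℝ, 0 ≤ s → Real.exp (-(r * s)) ≤ K * (1 + s) ^ (-((d : ℝ) + 1)) := by
    refine ⟨Real.exp r * ((d + 1).factorial / r ^ (d + 1)), fun s hs => ?_⟩
    have h1 : 0 < 1 + s := by linarith
    have h := Real.pow_div_factorial_le_exp (r * (1 + s)) (by positivity) (d + 1)
    have e : (1 + s) ^ (-((d : ℝ) + 1)) = ((1 + s) ^ (d + 1))⁻¹ := by
      rw [Real.rpow_neg h1.le]; congr 1; exact_mod_cast Real.rpow_natCast (1 + s) (d + 1)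
    have e2 : Real.exp (-(r * s)) = Real.exp r * (Real.exp (r * (1 + s)))⁻¹ := by
      rw [← Real.exp_neg, ← Real.exp_add]; ring_nf
    rw [e, e2, mul_assoc]
    refine mul_le_mul_of_nonneg_left ?_ (Real.exp_pos _).le
    refine (inv_anti₀ (by positivity) h).trans (le_of_eq ?_)
    rw [mul_pow]; field_simp
  obtain ⟨K, hK⟩ := hb
  have hi : Integrable (fun φ : EuclideanSpace ℝ (Fin d) => (1 + ‖φ‖) ^ (-((d : ℝ) + 1))) volume :=
    integrable_one_add_norm (by simp)
  refine (hi.const_mul K).mono' (by fun_prop) (Filter.Eventually.of_forall fun φ => ?_)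
  rw [Real.norm_of_nonneg (Real.exp_pos _).le]
  exact hK _ (norm_nonneg _)

/-- For every point of a proper open convex cone, the defining integrand of the
characteristic function is integrable on the dual cone, and the characteristic
function is positive and finite. -/
theorem charFn_pos_finite {d : ℕ} (hd : 0 < d)
    (C : Set (EuclideanSpace ℝ (Fin d))) (hC : IsProperOpenConvexCone C)
    (x : EuclideanSpace ℝ (Fin d)) (hx : x ∈ C) :
    IntegrableOn (fun φ => Real.exp (-⟪φ, x⟫)) (dualConeSet C) volume ∧
    0 < charFn C x ∧ charFn C x < ⊤ := by
  have hmeas : MeasurableSet (dualConeSet C) := by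
    have : dualConeSet C = ⋂ c ∈ closure C, {φ | 0 ≤ ⟪φ, c⟫} := by
      ext φ; simp [dualConeSet]
    rw [this]
    exact (isClosed_biInter fun c _ => isClosed_le continuous_const (by fun_prop)).measurableSet
  have hint : IntegrableOn (fun φ => Real.exp (-⟪φ, x⟫)) (dualConeSet C) volume := by
    obtain ⟨r, hr, hball⟩ := Metric.isOpen_iff.1 hC.isOpen x hx
    refine (integrable_exp_neg_norm_aux (d := d) (r / 2) (by positivity)).integrableOn.mono'
      (Continuous.aestronglyMeasurable (by fun_prop)) ?_
    refine (ae_restrict_iff' hmeas).2 (Filter.Eventually.of_forall fun φ hφ => ?_)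
    rw [Real.norm_of_nonneg (Real.exp_pos _).le, Real.exp_le_exp, neg_le_neg_iff]
    by_cases h0 : φ = 0
    · simp [h0]
    have hn : 0 < ‖φ‖ := norm_pos_iff.2 h0
    have hm : x - (r / 2 / ‖φ‖) • φ ∈ C := hball (by
      rw [Metric.mem_ball, dist_eq_norm, sub_sub_cancel_left, norm_neg, norm_smul,
        Real.norm_of_nonneg (by positivity), div_mul_cancel₀ _ hn.ne']
      linarith)
    have h := hφ _ (subset_closure hm)
    rw [inner_sub_right, real_inner_smul_right, real_inner_self_eq_norm_sq] at h
    have e : r / 2 / ‖φ‖ * ‖φ‖ ^ 2 = r / 2 * ‖φ‖ := by field_simp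
    linarith
  refine ⟨hint, ?_, ?_⟩
  · unfold charFn
    rw [lintegral_pos_iff_support (by fun_prop)]
    have hs : (Function.support fun φ : EuclideanSpace ℝ (Fin d) =>
        ENNReal.ofReal (Real.exp (-⟪φ, x⟫))) = univ := by
      ext φ; simp [Real.exp_pos]
    rw [hs, Measure.restrict_apply_univ]
    exact Measure.measure_pos_of_nonempty_interior _ (dual_interior C hC)
  · unfold charFn
    exact hint.lintegral_lt_top
end

section
/- Let C ⊆ ℝ^d be a proper open convex cone. The characteristic function f_C is a convex function on C, i.e. for x, y ∈ C and s ∈ [0,1], f_C(s•x + (1−s)•y) ≤ s·f_C(x) + (1−s)·f_C(y). Consequently, for every c > 0 the sublevel set {x ∈ C : f_C(x) ≤ c} (the region on or above the Vinberg hypersurface f_C = c) is convex. -/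
open MeasureTheory Set
open scoped RealInnerProductSpace ENNReal

/-- The characteristic function is convex on C, and hence the region on or above
each Vinberg hypersurface (the sublevel set) is convex. -/
theorem charFn_convex {d : ℕ} (hd : 0 < d)
    (C : Set (EuclideanSpace ℝ (Fin d))) (hC : IsProperOpenConvexCone C) :
    (∀ x ∈ C, ∀ y ∈ C, ∀ s : ℝ, 0 ≤ s → s ≤ 1 →
      charFn C (s • x + (1 - s) • y) ≤
        ENNReal.ofReal s * charFn C x + ENNReal.ofReal (1 - s) * charFn C y) ∧
    (∀ c : ℝ, 0 < c →
      Convex ℝ {x | x ∈ C ∧ charFn C x ≤ ENNReal.ofReal c}) := by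
  have h1 : ∀ x ∈ C, ∀ y ∈ C, ∀ s : ℝ, 0 ≤ s → s ≤ 1 →
      charFn C (s • x + (1 - s) • y) ≤
        ENNReal.ofReal s * charFn C x + ENNReal.ofReal (1 - s) * charFn C y := by
    intro x _ y _ s hs0 hs1
    have hs1' : 0 ≤ 1 - s := by linarith
    have hm : ∀ z : EuclideanSpace ℝ (Fin d), Measurable
        fun φ : EuclideanSpace ℝ (Fin d) => ENNReal.ofReal (Real.exp (-⟪φ, z⟫)) := by
      intro z
      have hc : Continuous fun φ : EuclideanSpace ℝ (Fin d) => Real.exp (-⟪φ, z⟫) := by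
        fun_prop
      exact hc.measurable.ennreal_ofReal
    unfold charFn
    rw [← lintegral_const_mul _ (hm x), ← lintegral_const_mul _ (hm y),
      ← lintegral_add_left ((hm x).const_mul _)]
    apply lintegral_mono
    intro φ
    dsimp only
    rw [← ENNReal.ofReal_mul hs0, ← ENNReal.ofReal_mul hs1',
      ← ENNReal.ofReal_add (by positivity) (mul_nonneg hs1' (Real.exp_pos _).le)]
    apply ENNReal.ofReal_le_ofReal
    have h := convexOn_exp.2 (mem_univ (-⟪φ, x⟫)) (mem_univ (-⟪φ, y⟫)) hs0 hs1' (by ring)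
    simp only [smul_eq_mul] at h
    rw [inner_add_right, real_inner_smul_right, real_inner_smul_right]
    calc _ = _ := by congr 1; ring
      _ ≤ _ := h
  refine ⟨h1, ?_⟩
  rintro c _ x ⟨hx, hxc⟩ y ⟨hy, hyc⟩ a b ha hb hab
  refine ⟨hC.convex hx hy ha hb hab, ?_⟩
  obtain rfl : b = 1 - a := by linarith
  refine (h1 x hx y hy a ha (by linarith)).trans ?_
  calc _ ≤ ENNReal.ofReal a * ENNReal.ofReal c + ENNReal.ofReal (1 - a) * ENNReal.ofReal c := by
        gcongr
    _ = ENNReal.ofReal c := by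
        rw [← add_mul, ← ENNReal.ofReal_add ha hb, hab, ENNReal.ofReal_one, one_mul]
end

section
/- Let C ⊆ ℝ^d be a proper open convex cone, let w ∈ C, and let v ∈ L be a point of the lightcone of C (v ∈ frontier C, v ≠ 0). Then f_C(w + s•v) tends to 0 as s → ∞; i.e. along any ray in C asymptotic to a boundary ray, the characteristic function tends to 0, so the ray eventually lies above every Vinberg hypersurface. -/
open MeasureTheory Set
open scoped RealInnerProductSpace ENNReal

lemma measurableSet_dualConeSet {d : ℕ} (C : Set (EuclideanSpace ℝ (Fin d))) :
    MeasurableSet (dualConeSet C) := by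
  have : dualConeSet C = ⋂ x ∈ closure C, {φ | 0 ≤ ⟪φ, x⟫} := by
    ext φ
    simp [dualConeSet]
  rw [this]
  refine IsClosed.measurableSet ?_
  refine isClosed_biInter fun x _ => ?_
  exact isClosed_le continuous_const (by fun_prop)

/-- An interior point pairs with the dual cone with a linear lower bound. -/
lemma exists_inner_lower_bound {d : ℕ} (C : Set (EuclideanSpace ℝ (Fin d))) (hC : IsOpen C)
    (w : EuclideanSpace ℝ (Fin d)) (hw : w ∈ C) :
    ∃ c : ℝ, 0 < c ∧ ∀ φ ∈ dualConeSet C, c * ‖φ‖ ≤ ⟪φ, w⟫ := by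
  obtain ⟨r, hr, hball⟩ := Metric.isOpen_iff.1 hC w hw
  refine ⟨r / 2, by positivity, fun φ hφ => ?_⟩
  by_cases h0 : φ = 0
  · simp [h0]
  have hn : 0 < ‖φ‖ := norm_pos_iff.2 h0
  have hmem : w - ((r / 2) / ‖φ‖) • φ ∈ C := by
    apply hball
    rw [mem_ball_iff_norm, sub_sub_cancel_left, norm_neg, norm_smul, Real.norm_eq_abs,
      abs_of_pos (by positivity), div_mul_cancel₀ _ hn.ne']
    linarith
  have h := hφ _ (subset_closure hmem)
  rw [inner_sub_right, inner_smul_right, real_inner_self_eq_norm_sq] at h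
  have h2 : (r / 2) / ‖φ‖ * ‖φ‖ ^ 2 = r / 2 * ‖φ‖ := by
    field_simp
  linarith

lemma integrable_exp_neg_mul_norm {d : ℕ} (hd : 0 < d) {c : ℝ} (hc : 0 < c) :
    Integrable (fun φ : EuclideanSpace ℝ (Fin d) => Real.exp (-(c * ‖φ‖))) := by
  have : Nonempty (Fin d) := ⟨⟨0, hd⟩⟩
  have : Nontrivial (EuclideanSpace ℝ (Fin d)) := inferInstance
  refine (integrable_fun_norm_addHaar (μ := (volume : Measure (EuclideanSpace ℝ (Fin d))))
    (f := fun y : ℝ => Real.exp (-(c * y)))).2 ?_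
  have h := integrableOn_rpow_mul_exp_neg_mul_rpow (p := 1) (s := ((d - 1 : ℕ) : ℝ)) (b := c)
    (by have : (0 : ℝ) ≤ ((d - 1 : ℕ) : ℝ) := Nat.cast_nonneg _
        linarith) one_pos hc
  simpa [Real.rpow_natCast] using h

lemma ae_inner_ne_zero {d : ℕ} (v : EuclideanSpace ℝ (Fin d)) (hv : v ≠ 0) :
    ∀ᵐ φ : EuclideanSpace ℝ (Fin d), ⟪φ, v⟫ ≠ 0 := by
  have h := Measure.addHaar_submodule (volume : Measure (EuclideanSpace ℝ (Fin d)))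
    (ℝ ∙ v)ᗮ (by
      intro htop
      have : v ∈ (ℝ ∙ v)ᗮ := htop ▸ Submodule.mem_top
      rw [Submodule.mem_orthogonal_singleton_iff_inner_right] at this
      exact hv (inner_self_eq_zero.1 this))
  rw [ae_iff]
  convert h using 2
  ext φ
  simp [Submodule.mem_orthogonal_singleton_iff_inner_left]

/-- Along a ray asymptotic to a boundary ray of the cone, the characteristic
function tends to zero. -/
theorem charFn_tendsto_zero {d : ℕ} (hd : 0 < d)
    (C : Set (EuclideanSpace ℝ (Fin d))) (hC : IsProperOpenConvexCone C)
    (w : EuclideanSpace ℝ (Fin d)) (hw : w ∈ C)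
    (v : EuclideanSpace ℝ (Fin d)) (hv : v ∈ frontier C \ {0}) :
    Filter.Tendsto (fun s : ℝ => charFn C (w + s • v)) Filter.atTop (nhds 0) := by
  obtain ⟨c, hc, hlow⟩ := exists_inner_lower_bound C hC.isOpen w hw
  have hvC : v ∈ closure C := frontier_subset_closure hv.1
  have hv0 : v ≠ 0 := hv.2
  have hmeas := measurableSet_dualConeSet C
  have key := tendsto_lintegral_filter_of_dominated_convergence
    (μ := volume.restrict (dualConeSet C)) (l := Filter.atTop)
    (F := fun (s : ℝ) φ => ENNReal.ofReal (Real.exp (-⟪φ, w + s • v⟫)))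
    (f := fun _ => 0)
    (fun φ => ENNReal.ofReal (Real.exp (-(c * ‖φ‖))))
    (Filter.Eventually.of_forall fun s => by fun_prop)
    (by
      filter_upwards [Filter.eventually_ge_atTop (0 : ℝ)] with s hs
      filter_upwards [ae_restrict_mem hmeas] with φ hφ
      apply ENNReal.ofReal_le_ofReal
      apply Real.exp_le_exp.2
      rw [inner_add_right, inner_smul_right]
      have h1 := hlow φ hφ
      have h2 := mul_nonneg hs (hφ v hvC)
      linarith)
    (by
      have h := (integrable_exp_neg_mul_norm hd hc).integrableOn (s := dualConeSet C)
      exact h.lintegral_lt_top.ne)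
    (by
      filter_upwards [ae_restrict_mem hmeas, ae_restrict_of_ae (ae_inner_ne_zero v hv0)]
        with φ hφ hne
      have hpos : 0 < ⟪φ, v⟫ := lt_of_le_of_ne (hφ v hvC) (Ne.symm hne)
      rw [← ENNReal.ofReal_zero]
      apply ENNReal.tendsto_ofReal
      apply Real.tendsto_exp_neg_atTop_nhds_zero.comp
      simp only [inner_add_right, inner_smul_right]
      exact Filter.tendsto_atTop_add_const_left _ _ (Filter.tendsto_id.atTop_mul_const hpos))
  simpa [charFn] using key
end

section
/- (Epstein–Penner discreteness, primal formulation.) Let C ⊆ ℝ^d be a proper open convex cone, let Γ be a group of linear automorphisms of ℝ^d such that every γ ∈ Γ satisfies |det γ| = 1 and γ(C) = C, and let p ∈ L be a point of the lightcone of C. Let D denote the interior of the dual cone C* and f_D its characteristic function. Assume there exists t > 0 such that, with Y = {ξ ∈ D : f_D(ξ) ≤ 1 and ⟪ξ, p⟫ ≤ t}, for every γ ∈ Γ: if (γ⁻¹)ᵀ(Y) ∩ Y ≠ ∅ then γ p = p. Then the orbit {γ p : γ ∈ Γ} is a closed discrete subset of ℝ^d (it has no accumulation point in ℝ^d). -/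
open MeasureTheory Set
open scoped RealInnerProductSpace ENNReal

section Helpers
variable {d : ℕ}

lemma ep_dual_closed (C : Set (EuclideanSpace ℝ (Fin d))) : IsClosed (dualConeSet C) := by
  have : dualConeSet C = ⋂ x ∈ closure C, {φ | 0 ≤ ⟪φ, x⟫} := by
    ext; simp [dualConeSet]
  rw [this]
  exact isClosed_biInter fun x _ => isClosed_le continuous_const (by fun_prop)

lemma ep_mem_dual {C : Set (EuclideanSpace ℝ (Fin d))} {φ : EuclideanSpace ℝ (Fin d)} :
    φ ∈ dualConeSet C ↔ ∀ x ∈ C, 0 ≤ ⟪φ, x⟫ := by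
  refine ⟨fun h x hx => h x (subset_closure hx), fun h x hx => ?_⟩
  have hcl : IsClosed {x : EuclideanSpace ℝ (Fin d) | 0 ≤ ⟪φ, x⟫} :=
    isClosed_le continuous_const (by fun_prop)
  exact closure_minimal (fun x hx => h x hx) hcl hx

lemma ep_dual_add {C : Set (EuclideanSpace ℝ (Fin d))} {φ ψ : EuclideanSpace ℝ (Fin d)}
    (h1 : φ ∈ dualConeSet C) (h2 : ψ ∈ dualConeSet C) : φ + ψ ∈ dualConeSet C := by
  intro x hx
  rw [inner_add_left]
  exact add_nonneg (h1 x hx) (h2 x hx)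

lemma ep_dual_smul {C : Set (EuclideanSpace ℝ (Fin d))} {φ : EuclideanSpace ℝ (Fin d)} {s : ℝ}
    (hs : 0 ≤ s) (h1 : φ ∈ dualConeSet C) : s • φ ∈ dualConeSet C := by
  intro x hx
  rw [real_inner_smul_left]
  exact mul_nonneg hs (h1 x hx)

lemma ep_dual_convex (C : Set (EuclideanSpace ℝ (Fin d))) : Convex ℝ (dualConeSet C) := by
  intro a ha b hb s t hs ht _
  exact ep_dual_add (ep_dual_smul hs ha) (ep_dual_smul ht hb)

/-- add an element of the dual cone to a positive multiple of an interior one -/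
lemma ep_interior_add {C : Set (EuclideanSpace ℝ (Fin d))} {φ ψ : EuclideanSpace ℝ (Fin d)} {s : ℝ}
    (h1 : φ ∈ dualConeSet C) (hs : 0 < s) (h2 : ψ ∈ interior (dualConeSet C)) :
    φ + s • ψ ∈ interior (dualConeSet C) := by
  let g : EuclideanSpace ℝ (Fin d) ≃ₜ EuclideanSpace ℝ (Fin d) :=
    (Homeomorph.smulOfNeZero s hs.ne').trans (Homeomorph.addLeft φ)
  have hg : ∀ x, g x = φ + s • x := fun x => rfl
  have : g '' interior (dualConeSet C) ⊆ interior (dualConeSet C) := by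
    apply interior_maximal
    · rintro _ ⟨x, hx, rfl⟩
      rw [hg]
      exact ep_dual_add h1 (ep_dual_smul hs.le (interior_subset hx))
    · exact g.isOpenMap _ isOpen_interior
  exact this ⟨ψ, h2, hg ψ⟩

lemma ep_zero_mem {C : Set (EuclideanSpace ℝ (Fin d))} (hC : IsProperOpenConvexCone C) :
    (0 : EuclideanSpace ℝ (Fin d)) ∈ closure C := by
  have : (0 : EuclideanSpace ℝ (Fin d)) ∈ closure C ∩ (-closure C) := by
    rw [hC.salient]; rfl
  exact this.1

lemma ep_bidual {C : Set (EuclideanSpace ℝ (Fin d))} (hC : IsProperOpenConvexCone C)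
    {v : EuclideanSpace ℝ (Fin d)} (hv : ∀ φ ∈ dualConeSet C, 0 ≤ ⟪φ, v⟫) : v ∈ closure C := by
  by_contra hn
  obtain ⟨f, u, h1, h2⟩ := geometric_hahn_banach_closed_point hC.convex.closure isClosed_closure hn
  have hu : 0 < u := by simpa using h1 0 (ep_zero_mem hC)
  have hle : ∀ a ∈ C, f a ≤ 0 := by
    intro a ha
    by_contra! hpos
    have := h1 ((u / f a) • a) (subset_closure (hC.smul_mem _ (by positivity) a ha))
    rw [map_smul, smul_eq_mul, div_mul_cancel₀ _ hpos.ne'] at this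
    exact lt_irrefl _ this
  have := hv (-(InnerProductSpace.toDual ℝ _).symm f) (ep_mem_dual.2 fun x hx => by
    rw [inner_neg_left, InnerProductSpace.toDual_symm_apply]
    linarith [hle x hx])
  rw [inner_neg_left, InnerProductSpace.toDual_symm_apply] at this
  linarith

lemma ep_interior_nonempty {C : Set (EuclideanSpace ℝ (Fin d))} (hC : IsProperOpenConvexCone C) :
    (interior (dualConeSet C)).Nonempty := by
  rw [(ep_dual_convex C).interior_nonempty_iff_affineSpan_eq_top]
  have h0 : (0 : EuclideanSpace ℝ (Fin d)) ∈ dualConeSet C := fun x _ => by simp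
  have hspan : Submodule.span ℝ (dualConeSet C) = ⊤ := by
    rw [← Submodule.orthogonal_eq_bot_iff, Submodule.eq_bot_iff]
    intro v hv
    have hv' : ∀ φ ∈ dualConeSet C, ⟪φ, v⟫ = 0 := fun φ hφ =>
      (Submodule.mem_orthogonal _ _).1 hv φ (Submodule.subset_span hφ)
    have h1 : v ∈ closure C := ep_bidual hC fun φ hφ => (hv' φ hφ).ge
    have h2 : -v ∈ closure C := ep_bidual hC fun φ hφ => by
      rw [inner_neg_right, hv' φ hφ, neg_zero]
    have : v ∈ closure C ∩ (-closure C) := ⟨h1, h2⟩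
    rw [hC.salient] at this
    exact this
  have h3 := affineSpan_insert_zero (k := ℝ) (dualConeSet C)
  rw [insert_eq_of_mem h0, hspan] at h3
  rw [← AffineSubspace.coe_eq_univ_iff, h3]
  rfl

lemma ep_finite {C : Set (EuclideanSpace ℝ (Fin d))} (hopen : IsOpen C)
    {ξ : EuclideanSpace ℝ (Fin d)} (hξ : ξ ∈ C) : charFn C ξ ≠ ∞ := by
  obtain ⟨c, hc, hball⟩ := Metric.isOpen_iff.1 hopen ξ hξ
  have hbd : ∀ x ∈ dualConeSet C, (c / 2) * ‖x‖ ≤ ⟪x, ξ⟫ := by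
    intro x hx
    rcases eq_or_ne x 0 with rfl | hx0
    · simp
    have hn : 0 < ‖x‖ := norm_pos_iff.2 hx0
    have hm : ξ - (c / 2 / ‖x‖) • x ∈ C := by
      apply hball
      rw [Metric.mem_ball, dist_eq_norm, sub_sub_cancel_left, norm_neg, norm_smul,
        Real.norm_of_nonneg (by positivity), div_mul_cancel₀ _ hn.ne']
      linarith
    have := ep_mem_dual.1 hx _ hm
    rw [inner_sub_right, real_inner_smul_right, real_inner_self_eq_norm_sq] at this
    have h3 : c / 2 / ‖x‖ * ‖x‖ ^ 2 = c / 2 * ‖x‖ := by field_simp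
    linarith
  have hle : ∀ x ∈ dualConeSet C, ENNReal.ofReal (Real.exp (-⟪x, ξ⟫)) ≤
      ENNReal.ofReal (Real.exp (c / 2) * (d + 1).factorial / (c / 2) ^ (d + 1)) *
        ENNReal.ofReal ((1 + ‖x‖) ^ (-((d + 1 : ℕ) : ℝ))) := by
    intro x hx
    rw [← ENNReal.ofReal_mul (by positivity)]
    apply ENNReal.ofReal_le_ofReal
    have h1 : Real.exp (-⟪x, ξ⟫) ≤ Real.exp (-(c / 2 * ‖x‖)) :=
      Real.exp_le_exp.2 (neg_le_neg (hbd x hx))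
    refine h1.trans ?_
    have h2 := Real.pow_div_factorial_le_exp (x := c / 2 * (1 + ‖x‖)) (by positivity) (d + 1)
    rw [Real.rpow_neg (by positivity), Real.rpow_natCast, Real.exp_neg, ← div_eq_mul_inv, div_div,
      inv_eq_one_div, div_le_div_iff₀ (by positivity) (by positivity), one_mul]
    rw [div_le_iff₀ (by positivity), mul_pow, mul_add, mul_one, Real.exp_add] at h2
    linarith
  have hfin := finite_integral_one_add_norm (μ := (volume : Measure (EuclideanSpace ℝ (Fin d))))
    (r := ((d + 1 : ℕ) : ℝ)) (by simp)
  refine ne_of_lt ?_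
  calc charFn C ξ ≤ ∫⁻ x in dualConeSet C, 
        ENNReal.ofReal (Real.exp (c / 2) * (d + 1).factorial / (c / 2) ^ (d + 1)) *
        ENNReal.ofReal ((1 + ‖x‖) ^ (-((d + 1 : ℕ) : ℝ))) :=
        setLIntegral_mono' (ep_dual_closed C).measurableSet hle
    _ ≤ ∫⁻ x : EuclideanSpace ℝ (Fin d), 
        ENNReal.ofReal (Real.exp (c / 2) * (d + 1).factorial / (c / 2) ^ (d + 1)) *
        ENNReal.ofReal ((1 + ‖x‖) ^ (-((d + 1 : ℕ) : ℝ))) := setLIntegral_le_lintegral _ _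
    _ < ∞ := by
      rw [lintegral_const_mul' _ _ ENNReal.ofReal_ne_top]
      exact ENNReal.mul_lt_top ENNReal.ofReal_lt_top hfin

/-- key existence -/
lemma ep_exists {C : Set (EuclideanSpace ℝ (Fin d))} (hC : IsProperOpenConvexCone C)
    {z : EuclideanSpace ℝ (Fin d)} (hz : z ∈ frontier C) {t : ℝ} (ht : 0 < t) :
    ∃ ξ ∈ interior (dualConeSet C), charFn (interior (dualConeSet C)) ξ ≤ 1 ∧ ⟪ξ, z⟫ < t := by
  obtain ⟨ξ₀, hξ₀⟩ := ep_interior_nonempty hC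
  have hzC : z ∉ C := by
    rw [hC.isOpen.frontier_eq] at hz; exact hz.2
  obtain ⟨f, hf⟩ := geometric_hahn_banach_open_point hC.convex hC.isOpen hzC
  obtain ⟨a, ha⟩ := hC.nonempty
  have hfz : 0 ≤ f z := by
    have hcl : IsClosed {x : EuclideanSpace ℝ (Fin d) | f x ≤ f z} :=
      isClosed_le (by fun_prop) continuous_const
    have h0 : f 0 ≤ f z := closure_minimal (fun x hx => (hf x hx).le) hcl (ep_zero_mem hC)
    simpa using h0
  have hneg : ∀ x ∈ C, f x ≤ 0 := by
    intro x hx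
    by_contra! hpos
    have := hf (((f z + 1) / f x) • x) (hC.smul_mem _ (by positivity) x hx)
    rw [map_smul, smul_eq_mul, div_mul_cancel₀ _ hpos.ne'] at this
    linarith
  have hfz0 : f z = 0 := by
    refine le_antisymm ?_ hfz
    have hcl : IsClosed {x : EuclideanSpace ℝ (Fin d) | f x ≤ 0} :=
      isClosed_le (by fun_prop) continuous_const
    exact closure_minimal hneg hcl (frontier_subset_closure hz)
  set η : EuclideanSpace ℝ (Fin d) := -(InnerProductSpace.toDual ℝ _).symm f with hη
  have hηf : ∀ x, ⟪η, x⟫ = - f x := fun x => by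
    rw [hη, inner_neg_left, InnerProductSpace.toDual_symm_apply]
  have hηd : η ∈ dualConeSet C := ep_mem_dual.2 fun x hx => by
    rw [hηf]; linarith [hneg x hx]
  have hη0 : η ≠ 0 := by
    intro h
    have h1 := hηf a
    rw [h, inner_zero_left] at h1
    have := hf a ha
    linarith
  have hz0 : 0 ≤ ⟪ξ₀, z⟫ := interior_subset hξ₀ z (frontier_subset_closure hz)
  set ε : ℝ := t / (⟪ξ₀, z⟫ + 1) with hε
  have hεpos : 0 < ε := by positivity
  have hεt : ε * ⟪ξ₀, z⟫ < t := by
    rw [hε, div_mul_eq_mul_div, div_lt_iff₀ (by positivity)]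
    nlinarith
  set D := interior (dualConeSet C) with hD
  have hξ : ∀ n : ℕ, (n : ℝ) • η + ε • ξ₀ ∈ D := fun n =>
    ep_interior_add (ep_dual_smul (Nat.cast_nonneg n) hηd) hεpos hξ₀
  have hclD : η ∈ closure D := by
    rw [hD, (ep_dual_convex C).closure_interior_eq_closure_of_nonempty_interior ⟨_, hξ₀⟩]
    exact subset_closure hηd
  have hlim : Filter.Tendsto (fun n : ℕ => charFn D ((n : ℝ) • η + ε • ξ₀)) Filter.atTop
      (nhds (∫⁻ x in dualConeSet D, 0)) := by
    unfold charFn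
    refine tendsto_lintegral_of_dominated_convergence
      (fun x => ENNReal.ofReal (Real.exp (-⟪x, ε • ξ₀⟫))) (fun n => by fun_prop) ?_ ?_ ?_
    · intro n
      refine (ae_restrict_iff' (ep_dual_closed D).measurableSet).2 (ae_of_all _ fun x hx => ?_)
      apply ENNReal.ofReal_le_ofReal
      apply Real.exp_le_exp.2
      rw [inner_add_right, real_inner_smul_right]
      have := mul_nonneg (Nat.cast_nonneg (α := ℝ) n) (hx η hclD)
      linarith
    · have := hξ 0
      simp only [Nat.cast_zero, zero_smul, zero_add] at this
      exact ep_finite isOpen_interior this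
    · have hnull : volume ({x : EuclideanSpace ℝ (Fin d) | ⟪η, x⟫ = 0}) = 0 := by
        have := Measure.addHaar_submodule (volume : Measure (EuclideanSpace ℝ (Fin d)))
          (LinearMap.ker (innerSL ℝ η).toLinearMap) (by
            intro h
            have : η ∈ LinearMap.ker (innerSL ℝ η).toLinearMap := by rw [h]; trivial
            simp at this
            exact hη0 this)
        convert this using 2
        ext x
        simp
      have hae : ∀ᵐ x : EuclideanSpace ℝ (Fin d), ⟪η, x⟫ ≠ 0 := by
        rw [ae_iff]; simpa using hnull
      refine (ae_restrict_iff' (ep_dual_closed D).measurableSet).2 ?_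
      filter_upwards [hae] with x hx0 hx
      have hpos : 0 < ⟪x, η⟫ := lt_of_le_of_ne (hx η hclD) (by
        rw [real_inner_comm]; exact hx0.symm)
      rw [← ENNReal.ofReal_zero]
      apply ENNReal.tendsto_ofReal
      refine Real.tendsto_exp_neg_atTop_nhds_zero.comp ?_
      simp only [inner_add_right, real_inner_smul_right]
      exact Filter.tendsto_atTop_add_const_right _ _
        (tendsto_natCast_atTop_atTop.atTop_mul_const hpos)
  rw [lintegral_zero] at hlim
  obtain ⟨n, hn⟩ := (hlim.eventually (gt_mem_nhds (zero_lt_one))).exists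
  refine ⟨_, hξ n, hn.le, ?_⟩
  rw [inner_add_left, real_inner_smul_left, real_inner_smul_left, hηf, hfz0]
  linarith

lemma ep_adj (γ : EuclideanSpace ℝ (Fin d) ≃ₗ[ℝ] EuclideanSpace ℝ (Fin d))
    {C : Set (EuclideanSpace ℝ (Fin d))} (h : γ '' C = C) {φ : EuclideanSpace ℝ (Fin d)} :
    LinearMap.adjoint γ.toLinearMap φ ∈ dualConeSet C ↔ φ ∈ dualConeSet C := by
  rw [ep_mem_dual, ep_mem_dual]
  conv_rhs => rw [← h]
  simp [LinearMap.adjoint_inner_left]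

lemma ep_adj_inv (γ : EuclideanSpace ℝ (Fin d) ≃ₗ[ℝ] EuclideanSpace ℝ (Fin d))
    (φ : EuclideanSpace ℝ (Fin d)) :
    LinearMap.adjoint γ.toLinearMap (LinearMap.adjoint γ.symm.toLinearMap φ) = φ := by
  refine ext_inner_right ℝ fun x => ?_
  simp [LinearMap.adjoint_inner_left]

/-- the adjoint as an equivalence -/
noncomputable def epAdjEquiv (γ : EuclideanSpace ℝ (Fin d) ≃ₗ[ℝ] EuclideanSpace ℝ (Fin d)) :
    EuclideanSpace ℝ (Fin d) ≃ₗ[ℝ] EuclideanSpace ℝ (Fin d) :=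
  { LinearMap.adjoint γ.toLinearMap with
    invFun := LinearMap.adjoint γ.symm.toLinearMap
    left_inv := fun x => by simpa using! ep_adj_inv γ.symm x
    right_inv := fun x => ep_adj_inv γ x }

lemma ep_adj_interior (γ : EuclideanSpace ℝ (Fin d) ≃ₗ[ℝ] EuclideanSpace ℝ (Fin d))
    {C : Set (EuclideanSpace ℝ (Fin d))} (h : γ '' C = C) {φ : EuclideanSpace ℝ (Fin d)} :
    LinearMap.adjoint γ.toLinearMap φ ∈ interior (dualConeSet C) ↔
      φ ∈ interior (dualConeSet C) := by
  have h1 := (epAdjEquiv γ).toContinuousLinearEquiv.toHomeomorph.preimage_interior (dualConeSet C)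
  have h2 : (epAdjEquiv γ).toContinuousLinearEquiv.toHomeomorph ⁻¹' (dualConeSet C)
      = dualConeSet C := by
    ext x; exact ep_adj γ h
  rw [h2] at h1
  exact Set.ext_iff.1 h1 φ

lemma ep_charFn (γ : EuclideanSpace ℝ (Fin d) ≃ₗ[ℝ] EuclideanSpace ℝ (Fin d))
    {C : Set (EuclideanSpace ℝ (Fin d))} (h : γ '' C = C)
    (hdet : |LinearMap.det γ.toLinearMap| = 1) (φ : EuclideanSpace ℝ (Fin d)) :
    charFn (interior (dualConeSet C)) (LinearMap.adjoint γ.toLinearMap φ) =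
      charFn (interior (dualConeSet C)) φ := by
  set D := interior (dualConeSet C) with hD
  have hpre : γ ⁻¹' (dualConeSet D) = dualConeSet D := by
    ext x
    rw [mem_preimage, ep_mem_dual, ep_mem_dual]
    constructor
    · intro hx ψ hψ
      have := hx (LinearMap.adjoint γ.symm.toLinearMap ψ)
        ((ep_adj_interior γ h).1 (by rw [ep_adj_inv]; exact hψ))
      simpa [LinearMap.adjoint_inner_right] using this
    · intro hx ψ hψ
      have := hx (LinearMap.adjoint γ.toLinearMap ψ) ((ep_adj_interior γ h).2 hψ)
      simpa [LinearMap.adjoint_inner_right] using this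
  have hmap : Measure.map γ (volume : Measure (EuclideanSpace ℝ (Fin d))) = volume := by
    have := Measure.map_linearMap_addHaar_eq_smul_addHaar
      (volume : Measure (EuclideanSpace ℝ (Fin d))) (f := γ.toLinearMap)
      (by intro h0; rw [h0] at hdet; simp at hdet)
    rw [abs_inv, hdet] at this
    simpa using this
  have hγm : Measurable γ := γ.toContinuousLinearEquiv.continuous.measurable
  unfold charFn
  conv_rhs => rw [← hmap]
  rw [setLIntegral_map (ep_dual_closed D).measurableSet (by fun_prop) hγm, hpre]
  simp [LinearMap.adjoint_inner_right]

end Helpers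

/-- Epstein–Penner discreteness, primal formulation: if a dual horoball at a
lightcone point p is precisely invariant, then the orbit of p has no
accumulation point in ℝ^d (it is closed and discrete). -/
theorem epstein_penner_primal {d : ℕ} (hd : 0 < d)
    (C : Set (EuclideanSpace ℝ (Fin d))) (hC : IsProperOpenConvexCone C)
    (Γ : Subgroup (EuclideanSpace ℝ (Fin d) ≃ₗ[ℝ] EuclideanSpace ℝ (Fin d)))
    (hdet : ∀ γ ∈ Γ, |LinearMap.det γ.toLinearMap| = 1)
    (hΓC : ∀ γ ∈ Γ, γ '' C = C)
    (p : EuclideanSpace ℝ (Fin d)) (hp : p ∈ frontier C \ {0})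
    (t : ℝ) (ht : 0 < t)
    (hprec : ∀ γ ∈ Γ,
      (LinearMap.adjoint (γ⁻¹ : EuclideanSpace ℝ (Fin d) ≃ₗ[ℝ]
          EuclideanSpace ℝ (Fin d)).toLinearMap ''
        {ξ | ξ ∈ interior (dualConeSet C) ∧ charFn (interior (dualConeSet C)) ξ ≤ 1 ∧
          ⟪ξ, p⟫ ≤ t} ∩
        {ξ | ξ ∈ interior (dualConeSet C) ∧ charFn (interior (dualConeSet C)) ξ ≤ 1 ∧
          ⟪ξ, p⟫ ≤ t}).Nonempty →
      γ p = p) :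
    ∀ z : EuclideanSpace ℝ (Fin d),
      ¬ AccPt z (Filter.principal {x | ∃ γ ∈ Γ, x = γ p}) := by
  intro z hz
  set S : Set (EuclideanSpace ℝ (Fin d)) := {x | ∃ γ ∈ Γ, x = γ p} with hS
  have hSfr : S ⊆ frontier C := by
    rintro x ⟨γ, hγ, rfl⟩
    have h1 := γ.toContinuousLinearEquiv.toHomeomorph.image_frontier C
    have h2 : γ.toContinuousLinearEquiv.toHomeomorph '' C = C := hΓC γ hγ
    rw [h2] at h1
    rw [← h1]
    exact ⟨p, hp.1, rfl⟩
  have hzfr : z ∈ frontier C :=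
    closure_minimal hSfr isClosed_frontier (mem_closure_iff_clusterPt.2 hz.clusterPt)
  obtain ⟨ξ, hξD, hξ1, hξt⟩ := ep_exists hC hzfr ht
  have key : ∀ x ∈ S, ∀ y ∈ S, ⟪ξ, x⟫ < t → ⟪ξ, y⟫ < t → x = y := by
    rintro _ ⟨α, hα, rfl⟩ _ ⟨β, hβ, rfl⟩ hx hy
    have hmem : ∀ γ ∈ Γ, ⟪ξ, γ p⟫ < t → LinearMap.adjoint γ.toLinearMap ξ ∈
        {ξ | ξ ∈ interior (dualConeSet C) ∧ charFn (interior (dualConeSet C)) ξ ≤ 1 ∧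
          ⟪ξ, p⟫ ≤ t} := by
      intro γ hγ h
      refine ⟨(ep_adj_interior γ (hΓC γ hγ)).2 hξD, ?_, ?_⟩
      · rw [ep_charFn γ (hΓC γ hγ) (hdet γ hγ)]; exact hξ1
      · rw [LinearMap.adjoint_inner_left]; exact h.le
    have := hprec (β⁻¹ * α) (Γ.mul_mem (Γ.inv_mem hβ) hα)
      ⟨LinearMap.adjoint β.toLinearMap ξ, ⟨_, hmem α hα hx, ?_⟩, hmem β hβ hy⟩
    · have h2 := congrArg β this
      simpa [LinearEquiv.mul_apply] using h2
    · refine ext_inner_right ℝ fun x => ?_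
      simp [LinearMap.adjoint_inner_left, mul_inv_rev, LinearEquiv.mul_apply]
  have hU : ∀ᶠ x in nhds z, ⟪ξ, x⟫ < t :=
    (isOpen_lt (f := fun x : EuclideanSpace ℝ (Fin d) => ⟪ξ, x⟫) (by fun_prop)
      continuous_const).mem_nhds hξt
  rw [accPt_iff_frequently] at hz
  obtain ⟨x, ⟨hxz, hxS⟩, hx⟩ := (hz.and_eventually hU).exists
  obtain ⟨y, ⟨hyz, hyS⟩, hy, hyx⟩ :=
    (hz.and_eventually (hU.and (isOpen_ne.mem_nhds hxz.symm))).exists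
  exact hyx (key y hyS x hxS hy hx)
end

section
/- Let C ⊆ ℝ^d be a proper open convex cone with closure K, and let P ⊆ K be a set that is closed in ℝ^d and does not contain 0. Then 0 does not belong to the closure of the convex hull of P: 0 ∉ closure(convexHull ℝ P). -/
open MeasureTheory Set
open scoped RealInnerProductSpace ENNReal

/-- A closed subset of the closure of a proper open convex cone that misses the
origin has the origin outside the closure of its convex hull. -/
theorem zero_not_mem_closure_convexHull {d : ℕ} (hd : 0 < d)
    (C : Set (EuclideanSpace ℝ (Fin d))) (hC : IsProperOpenConvexCone C)
    (P : Set (EuclideanSpace ℝ (Fin d))) (hPK : P ⊆ closure C)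
    (hPclosed : IsClosed P) (hP0 : (0 : EuclideanSpace ℝ (Fin d)) ∉ P) :
    (0 : EuclideanSpace ℝ (Fin d)) ∉ closure (convexHull ℝ P) := by
  have hKc : Convex ℝ (closure C) := hC.convex.closure
  have hKs : ∀ t : ℝ, 0 < t → ∀ x ∈ closure C, t • x ∈ closure C := by
    intro t ht x hx
    exact map_mem_closure (f := fun y => t • y) (continuous_const_smul t) hx
      (fun y hy => hC.smul_mem t ht y hy)
  have hK0 : (0 : EuclideanSpace ℝ (Fin d)) ∈ closure C := by
    have h : (0 : EuclideanSpace ℝ (Fin d)) ∈ closure C ∩ (-closure C) := by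
      rw [hC.salient]; rfl
    exact h.1
  have hKa : ∀ x ∈ closure C, ∀ y ∈ closure C, x + y ∈ closure C := by
    intro x hx y hy
    have h := hKs 2 two_pos _ (hKc hx hy (a := 1/2) (b := 1/2) (by norm_num) (by norm_num)
      (by norm_num))
    rw [smul_add, smul_smul, smul_smul] at h
    norm_num at h
    exact h
  -- uniform lower bound
  obtain ⟨c, hc, hcb⟩ : ∃ c : ℝ, 0 < c ∧ ∀ x ∈ closure C, ∀ y ∈ closure C,
      c * ‖x‖ ≤ ‖x + y‖ := by
    have hcomp : IsCompact (Metric.sphere (0 : EuclideanSpace ℝ (Fin d)) 1 ∩ closure C) :=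
      (isCompact_sphere _ _).inter_right isClosed_closure
    have hdis : Disjoint (Metric.sphere (0 : EuclideanSpace ℝ (Fin d)) 1 ∩ closure C)
        (-closure C) := by
      rw [Set.disjoint_left]
      rintro x ⟨hx1, hx2⟩ hx3
      have h : x ∈ closure C ∩ (-closure C) := ⟨hx2, hx3⟩
      rw [hC.salient, Set.mem_singleton_iff] at h
      simp [h] at hx1
    obtain ⟨r, hr, hrb⟩ := Metric.exists_pos_forall_lt_edist hcomp isClosed_closure.neg hdis
    refine ⟨r, hr, fun x hx y hy => ?_⟩
    rcases eq_or_ne x 0 with rfl | hx0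
    · simp
    have hn : 0 < ‖x‖ := norm_pos_iff.mpr hx0
    have hi : 0 < ‖x‖⁻¹ := inv_pos.mpr hn
    have h := hrb (‖x‖⁻¹ • x) ⟨by simp [norm_smul, hn.ne'], hKs _ hi x hx⟩
      (-(‖x‖⁻¹ • y)) (by simpa using hKs _ hi y hy)
    rw [edist_nndist, ENNReal.coe_lt_coe, ← NNReal.coe_lt_coe, coe_nndist, dist_eq_norm,
      sub_neg_eq_add, ← smul_add, norm_smul, norm_inv, norm_norm] at h
    rw [← div_eq_inv_mul, lt_div_iff₀ hn] at h
    exact h.le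
  obtain ⟨r, hr, hrP⟩ : ∃ r : ℝ, 0 < r ∧ ∀ x ∈ P, r ≤ ‖x‖ := by
    obtain ⟨r, hr, hb⟩ := Metric.isOpen_iff.mp hPclosed.isOpen_compl 0 hP0
    refine ⟨r, hr, fun x hx => ?_⟩
    by_contra h
    exact hb (by simpa using h) hx
  intro h0
  obtain ⟨x, hx, hxd⟩ := Metric.mem_closure_iff.mp h0 (c * (r / (d + 1))) (by positivity)
  rw [dist_zero_left] at hxd
  obtain ⟨ι, _, z, w, hz, hai, hw, hw1, rfl⟩ := eq_pos_convex_span_of_mem_convexHull hx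
  have hcard : Fintype.card ι ≤ d + 1 := by
    refine hai.card_le_finrank_succ.trans ?_
    have := Submodule.finrank_le (vectorSpan ℝ (Set.range z))
    simp at this
    omega
  obtain ⟨i, hi⟩ : ∃ i, 1 / ((d : ℝ) + 1) ≤ w i := by
    by_contra! h
    have hne : (Finset.univ : Finset ι).Nonempty := by
      by_contra he
      rw [Finset.not_nonempty_iff_eq_empty] at he
      simp [he] at hw1
    have h1 := Finset.sum_lt_sum_of_nonempty hne (fun i _ => h i)
    rw [hw1, Finset.sum_const, nsmul_eq_mul, Finset.card_univ] at h1
    have h2 : (Fintype.card ι : ℝ) ≤ d + 1 := by exact_mod_cast hcard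
    rw [mul_one_div, lt_div_iff₀ (by positivity)] at h1
    linarith
  classical
  have hmem : ∀ j, w j • z j ∈ closure C := fun j => hKs _ (hw j) _ (hPK (hz ⟨j, rfl⟩))
  have hsum : ∑ j ∈ Finset.univ.erase i, w j • z j ∈ closure C :=
    Finset.sum_induction _ (· ∈ closure C) (fun a b ha hb => hKa a ha b hb) hK0
      (fun j _ => hmem j)
  have hb := hcb _ (hmem i) _ hsum
  rw [Finset.add_sum_erase _ (fun j => w j • z j) (Finset.mem_univ i), norm_smul,
    Real.norm_of_nonneg (hw i).le] at hb
  have h3 : r / (d + 1) ≤ w i * ‖z i‖ := by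
    calc r / ((d : ℝ) + 1) = 1 / ((d : ℝ) + 1) * r := by ring
      _ ≤ w i * ‖z i‖ := mul_le_mul hi (hrP _ (hz ⟨i, rfl⟩)) hr.le (hw i).le
  have h4 := mul_le_mul_of_nonneg_left h3 hc.le
  linarith
end

section
/- Let C ⊆ ℝ^d be a strictly convex proper open convex cone and let P ⊆ L be an admissible vertex set. Then for every w ∈ L: w belongs to D(P) = closure(convexHull ℝ P) if and only if w = α • z for some z ∈ P and some real α ≥ 1. -/
open MeasureTheory Set
open scoped RealInnerProductSpace ENNReal

/-- `C` is strictly convex: any segment between two lightcone points that lies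
entirely in the frontier of `C` is degenerate (the endpoints lie on one ray). -/
def IsStrictlyConvexCone {d : ℕ} (C : Set (EuclideanSpace ℝ (Fin d))) : Prop :=
  ∀ x ∈ frontier C \ {0}, ∀ y ∈ frontier C \ {0},
    segment ℝ x y ⊆ frontier C → ∃ a : ℝ, 0 < a ∧ y = a • x

/-- `P` is an admissible vertex set for the cone `C`: a closed discrete subset
of the lightcone `L = frontier C \ {0}` such that every lightcone direction is
approximated by directions of points of `P` of arbitrarily large norm. -/
def IsAdmissibleVertexSet {d : ℕ} (C P : Set (EuclideanSpace ℝ (Fin d))) : Prop :=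
  P ⊆ frontier C \ {0} ∧ IsClosed P ∧
  (∀ p ∈ P, ∃ ε > 0, ∀ q ∈ P, q ≠ p → ε ≤ ‖q - p‖) ∧
  ∀ u ∈ frontier C \ {0}, ∀ ε : ℝ, 0 < ε → ∀ R : ℝ, 0 < R →
    ∃ p ∈ P, R < ‖p‖ ∧ ‖‖p‖⁻¹ • p - ‖u‖⁻¹ • u‖ < ε

/-- A lightcone point lies in the closed convex hull of an admissible vertex
set iff it is a multiple α • z, α ≥ 1, of a vertex z ∈ P. -/
theorem mem_closure_convexHull_iff {d : ℕ} (hd : 0 < d)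
    (C : Set (EuclideanSpace ℝ (Fin d))) (hC : IsProperOpenConvexCone C)
    (hstrict : IsStrictlyConvexCone C)
    (P : Set (EuclideanSpace ℝ (Fin d))) (hP : IsAdmissibleVertexSet C P)
    (w : EuclideanSpace ℝ (Fin d)) (hw : w ∈ frontier C \ {0}) :
    w ∈ closure (convexHull ℝ P) ↔ ∃ z ∈ P, ∃ α : ℝ, 1 ≤ α ∧ w = α • z := by
  obtain ⟨hPL, hPc, -, hPdir⟩ := hP
  constructor
  · intro hwD
    have hfr : frontier C ⊆ closure C := frontier_subset_closure
    have hKc : Convex ℝ (closure C) := hC.convex.closure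
    have hKs : ∀ t : ℝ, 0 < t → ∀ x ∈ closure C, t • x ∈ closure C := by
      intro t ht x hx
      exact map_mem_closure (continuous_const_smul t) hx (fun y hy => hC.smul_mem t ht y hy)
    obtain ⟨hwF, hw0⟩ := hw
    have hw0 : w ≠ 0 := hw0
    have hwC : w ∉ C := by
      intro h
      rw [hC.isOpen.frontier_eq] at hwF
      exact hwF.2 h
    -- supporting functional
    obtain ⟨f, hf⟩ := geometric_hahn_banach_open_point hC.convex hC.isOpen hwC
    have hfK : ∀ x ∈ closure C, f x ≤ f w := by
      intro x hx
      exact closure_minimal (fun y hy => (hf y hy).le)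
        (isClosed_le f.continuous continuous_const) hx
    have hfw : f w = 0 := by
      have h1 := hfK _ (hKs 2 (by norm_num) w (hfr hwF))
      have h2 := hfK _ (hKs (1/2) (by norm_num) w (hfr hwF))
      simp only [map_smul, smul_eq_mul] at h1 h2
      linarith
    rw [hfw] at hf hfK
    have hray : ∀ x ∈ closure C, x ≠ 0 → f x = 0 → ∃ a : ℝ, 0 < a ∧ x = a • w := by
      intro x hx hx0 hfx
      have key : ∀ y ∈ closure C, f y = 0 → y ∈ frontier C := by
        intro y hy hfy
        rw [hC.isOpen.frontier_eq]
        exact ⟨hy, fun h => (hf y h).ne hfy⟩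
      refine hstrict w ⟨hwF, hw0⟩ x ⟨key x hx hfx, hx0⟩ ?_
      intro y hy
      refine key y (hKc.segment_subset (hfr hwF) hx hy) ?_
      obtain ⟨a, b, -, -, -, rfl⟩ := hy
      simp [hfw, hfx]
    -- strictly positive functional
    have h0K : (0 : EuclideanSpace ℝ (Fin d)) ∈ closure C := by
      have : (0 : EuclideanSpace ℝ (Fin d)) ∈ closure C ∩ (-closure C) := by
        rw [hC.salient]; rfl
      exact this.1
    have hScomp : IsCompact (closure C ∩ Metric.sphere (0 : EuclideanSpace ℝ (Fin d)) 1) :=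
      (isCompact_sphere _ _).inter_left isClosed_closure
    have hex : ∃ g : EuclideanSpace ℝ (Fin d) →L[ℝ] ℝ, (∀ x ∈ closure C, 0 ≤ g x) ∧
        ∀ x ∈ closure C ∩ Metric.sphere (0 : EuclideanSpace ℝ (Fin d)) 1, 0 < g x := by
      refine hScomp.induction_on (p := fun s => ∃ g : EuclideanSpace ℝ (Fin d) →L[ℝ] ℝ,
        (∀ x ∈ closure C, 0 ≤ g x) ∧ ∀ x ∈ closure C ∩ s, 0 < g x) ?_ ?_ ?_ ?_ |>.imp ?_
      · exact ⟨0, by simp, by simp⟩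
      · rintro s t hst ⟨g, h1, h2⟩
        exact ⟨g, h1, fun x hx => h2 x ⟨hx.1, hst hx.2⟩⟩
      · rintro s t ⟨g, h1, h2⟩ ⟨g', h1', h2'⟩
        refine ⟨g + g', fun x hx => add_nonneg (h1 x hx) (h1' x hx), ?_⟩
        rintro x ⟨hx, hxs | hxt⟩
        · exact add_pos_of_pos_of_nonneg (h2 x ⟨hx, hxs⟩) (h1' x hx)
        · exact add_pos_of_nonneg_of_pos (h1 x hx) (h2' x ⟨hx, hxt⟩)
      · rintro x ⟨hx, hx1⟩
        have hnx : -x ∉ closure C := by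
          intro h
          have h2 : x ∈ closure C ∩ (-closure C) := ⟨hx, h⟩
          rw [hC.salient] at h2
          have h3 : x = 0 := h2
          simp [h3] at hx1
        obtain ⟨g, u, hgx, hgu⟩ := geometric_hahn_banach_point_closed hKc isClosed_closure hnx
        have hu0 : u < 0 := by simpa using hgu 0 h0K
        have hgpos : 0 < g x := by
          rw [map_neg] at hgx
          linarith
        refine ⟨{y | 0 < g y}, mem_nhdsWithin_of_mem_nhds
          ((isOpen_lt continuous_const g.continuous).mem_nhds hgpos), g, ?_, fun y hy => hy.2⟩
        intro y hy
        by_contra! hneg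
        have h4 := hgu _ (hKs (u / g y) (div_pos_of_neg_of_neg hu0 hneg) y hy)
        rw [map_smul, smul_eq_mul, div_mul_cancel₀ _ hneg.ne] at h4
        exact lt_irrefl _ h4
      · rintro g ⟨h1, h2⟩
        exact ⟨h1, fun x hx => h2 x ⟨hx.1, hx⟩⟩
    obtain ⟨g, -, hgS⟩ := hex
    have hwn : 0 < ‖w‖ := norm_pos_iff.2 hw0
    obtain ⟨x₀, hx₀, hmin⟩ := hScomp.exists_isMinOn
      ⟨‖w‖⁻¹ • w, hKs _ (inv_pos.2 hwn) w (hfr hwF), by simp [norm_smul, hwn.ne']⟩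
      g.continuous.continuousOn
    obtain ⟨c, hc⟩ : ∃ c, c = g x₀ := ⟨_, rfl⟩
    have hc0 : 0 < c := hc ▸ hgS x₀ hx₀
    have hg : ∀ x ∈ closure C ∩ Metric.sphere (0 : EuclideanSpace ℝ (Fin d)) 1, c ≤ g x :=
      fun x hx => hc ▸ hmin hx
    have hgK : ∀ x ∈ closure C, c * ‖x‖ ≤ g x := by
      intro x hx
      by_cases hx0 : x = 0
      · simp [hx0]
      have hn : 0 < ‖x‖ := norm_pos_iff.2 hx0
      have h1 := hg (‖x‖⁻¹ • x)
        ⟨hKs _ (inv_pos.2 hn) x hx, by simp [norm_smul, hn.ne']⟩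
      rw [map_smul, smul_eq_mul, inv_mul_eq_div, le_div_iff₀ hn] at h1
      exact h1
    have hgw : 0 < g w :=
      lt_of_lt_of_le (mul_pos hc0 (norm_pos_iff.2 hw0)) (hgK w (hfr hwF))
    -- sequence
    have hseq : ∀ n : ℕ, ∃ p ∈ P, g p - (n + 1) * f p ≤ g w + 1 / ((n : ℝ) + 1) := by
      intro n
      by_contra! hcon
      have hsub : P ⊆ {x | g w + 1 / ((n : ℝ) + 1) ≤ (g - ((n : ℝ) + 1) • f) x} := by
        intro p hp
        simpa using (hcon p hp).le
      have hcl := closure_minimal (convexHull_min hsub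
        (convex_halfSpace_ge (g - ((n : ℝ) + 1) • f).toLinearMap.isLinear _))
        (isClosed_le continuous_const (g - ((n : ℝ) + 1) • f).continuous) hwD
      have hpos : 0 < 1 / ((n : ℝ) + 1) := by positivity
      have h2 : g w + 1 / ((n : ℝ) + 1) ≤ g w := by
        simpa [hfw] using hcl
      linarith
    choose p hpP hp using hseq
    have hpK : ∀ n, p n ∈ closure C := fun n => hfr (hPL (hpP n)).1
    have hle1 : ∀ n : ℕ, 1 / ((n : ℝ) + 1) ≤ 1 := by
      intro n
      rw [div_le_one (by positivity)]
      have : (0 : ℝ) ≤ n := n.cast_nonneg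
      linarith
    have hgp : ∀ n, g (p n) ≤ g w + 1 / ((n : ℝ) + 1) := by
      intro n
      have h1 := hp n
      have h2 : ((n : ℝ) + 1) * f (p n) ≤ 0 :=
        mul_nonpos_of_nonneg_of_nonpos (by positivity) (hfK _ (hpK n))
      linarith
    have hbd : ∀ n, p n ∈ Metric.closedBall (0 : EuclideanSpace ℝ (Fin d)) ((g w + 1) / c) := by
      intro n
      rw [mem_closedBall_zero_iff, le_div_iff₀ hc0]
      linarith [hgK _ (hpK n), hgp n, hle1 n]
    obtain ⟨q, -, φ, hφ, hlim⟩ := (isCompact_closedBall _ _).tendsto_subseq hbd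
    have hqP : q ∈ P := hPc.mem_of_tendsto hlim (Filter.Eventually.of_forall fun n => hpP _)
    have hqK : q ∈ closure C := hfr (hPL hqP).1
    have hflim := (f.continuous.tendsto q).comp hlim
    have hglim := (g.continuous.tendsto q).comp hlim
    have hone : Filter.Tendsto (fun n => 1 / ((φ n : ℝ) + 1)) Filter.atTop (nhds 0) :=
      (tendsto_one_div_add_atTop_nhds_zero_nat (𝕜 := ℝ)).comp hφ.tendsto_atTop
    have hgq : g q ≤ g w := by
      have := le_of_tendsto_of_tendsto' hglim (hone.const_add (g w)) (fun n => hgp (φ n))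
      simpa using this
    have hfq : f q = 0 := by
      refine le_antisymm (hfK q hqK) ?_
      have hb : ∀ n, -(g w + 2) * (1 / ((φ n : ℝ) + 1)) ≤ f (p (φ n)) := by
        intro n
        have hm : (0 : ℝ) < (φ n : ℝ) + 1 := by positivity
        rw [mul_one_div, div_le_iff₀ hm]
        have h1 := hp (φ n)
        have h2 := hle1 (φ n)
        have h3 : 0 ≤ g (p (φ n)) := le_trans (by positivity) (hgK _ (hpK (φ n)))
        linarith
      have := le_of_tendsto_of_tendsto' (hone.const_mul (-(g w + 2))) hflim hb
      simpa using this
    obtain ⟨a, ha, hqa⟩ := hray q hqK (hPL hqP).2 hfq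
    refine ⟨q, hqP, a⁻¹, ?_, ?_⟩
    · rw [one_le_inv₀ ha]
      rw [hqa, map_smul, smul_eq_mul] at hgq
      nlinarith
    · rw [hqa, smul_smul, inv_mul_cancel₀ ha.ne', one_smul]
  · rintro ⟨z, hz, α, hα, rfl⟩
    have hz0 : z ≠ 0 := (hPL hz).2
    have hzn : 0 < ‖z‖ := norm_pos_iff.2 hz0
    have hseq : ∀ n : ℕ, ∃ p ∈ P, (n : ℝ) + 1 < ‖p‖ ∧
        ‖‖p‖⁻¹ • p - ‖z‖⁻¹ • z‖ < 1 / ((n : ℝ) + 1) := fun n =>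
      hPdir z (hPL hz) _ (by positivity) _ (by positivity)
    choose p hpP hpn hpd using hseq
    set s : ℝ := (α - 1) * ‖z‖ with hs
    have hs0 : 0 ≤ s := mul_nonneg (by linarith) hzn.le
    have hdir : Filter.Tendsto (fun n => ‖p n‖⁻¹ • p n) Filter.atTop (nhds (‖z‖⁻¹ • z)) := by
      rw [tendsto_iff_norm_sub_tendsto_zero]
      exact squeeze_zero (fun n => norm_nonneg _) (fun n => (hpd n).le)
        tendsto_one_div_add_atTop_nhds_zero_nat
    have hnorm : Filter.Tendsto (fun n => ‖p n‖) Filter.atTop Filter.atTop :=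
      Filter.tendsto_atTop_mono (fun n => by linarith [hpn n]) tendsto_natCast_atTop_atTop
    have hinv : Filter.Tendsto (fun n => s * ‖p n‖⁻¹) Filter.atTop (nhds 0) := by
      simpa using (tendsto_inv_atTop_zero.comp hnorm).const_mul s
    have hlim : Filter.Tendsto (fun n => (1 - s * ‖p n‖⁻¹) • z + s • (‖p n‖⁻¹ • p n))
        Filter.atTop (nhds (α • z)) := by
      have h := ((hinv.const_sub 1).smul_const z).add (hdir.const_smul s)
      convert h using 2
      rw [smul_smul, hs, mul_assoc, mul_inv_cancel₀ hzn.ne', ← add_smul]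
      congr 1
      ring
    refine mem_closure_of_tendsto hlim ?_
    filter_upwards [hinv.eventually_le_const (show (0 : ℝ) < 1 by norm_num)] with n hn
    rw [smul_smul]
    exact convex_convexHull ℝ P (subset_convexHull ℝ P hz) (subset_convexHull ℝ P (hpP n))
      (by linarith) (by positivity) (by ring)
end
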